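/- The complement graph of the cycle C_9 does not admit a J-colouring. -/

import Mathlib

open SimpleGraph

/-- `c` is a proper colouring of `G` with colours `Fin k` such that the closed
neighbourhood of every vertex contains all `k` colours (a J-colouring). -/
def IsJColoring {V : Type*} (G : SimpleGraph V) (k : ℕ) (c : V → Fin k) : Prop :=
  (∀ ⦃u v : V⦄, G.Adj u v → c u ≠ c v) ∧
  ∀ v : V, ∀ i : Fin k, ∃ u : V, (u = v ∨ G.Adj v u) ∧ c u = i

/-- `G` has a J-colouring with `k` colours. -/
def HasJColoring {V : Type*} (G : SimpleGraph V) (k : ℕ) : Prop :=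
  ∃ c : V → Fin k, IsJColoring G k c

/-- `G` admits a J-colouring (with some number `k ≥ 1` of colours). -/
def AdmitsJColoring {V : Type*} (G : SimpleGraph V) : Prop :=
  ∃ k : ℕ, 1 ≤ k ∧ HasJColoring G k

/-- `c` is a proper colouring of `G` with colours `Fin k` such that the closed
neighbourhood of every internal vertex (vertex of degree at least 2) contains
all `k` colours (a J*-colouring). -/
def IsJStarColoring {V : Type*} (G : SimpleGraph V) (k : ℕ) (c : V → Fin k) : Prop :=
  (∀ ⦃u v : V⦄, G.Adj u v → c u ≠ c v) ∧
  ∀ v : V, (∃ a b : V, a ≠ b ∧ G.Adj v a ∧ G.Adj v b) →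
    ∀ i : Fin k, ∃ u : V, (u = v ∨ G.Adj v u) ∧ c u = i

/-- `G` has a J*-colouring with `k` colours. -/
def HasJStarColoring {V : Type*} (G : SimpleGraph V) (k : ℕ) : Prop :=
  ∃ c : V → Fin k, IsJStarColoring G k c

/-- The wheel graph `W_{n+1} = K_1 + C_n`: the cycle graph on `Fin n` together
with a central vertex `none` adjacent to every cycle vertex. -/
def wheelGraph (n : ℕ) : SimpleGraph (Option (Fin n)) :=
  SimpleGraph.fromRel (fun u v =>
    (∃ i : Fin n, u = none ∧ v = some i) ∨
    (∃ i j : Fin n, u = some i ∧ v = some j ∧ (SimpleGraph.cycleGraph n).Adj i j))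

/-- The Jahangir graph `J_{n,m}`: the cycle graph on `Fin (n*m)` together with a
central vertex `none` adjacent exactly to the `m` cycle vertices whose index is
a multiple of `n`. -/
def jahangirGraph (n m : ℕ) : SimpleGraph (Option (Fin (n * m))) :=
  SimpleGraph.fromRel (fun u v =>
    (∃ i : Fin (n * m), u = none ∧ v = some i ∧ n ∣ (i : ℕ)) ∨
    (∃ i j : Fin (n * m), u = some i ∧ v = some j ∧ (SimpleGraph.cycleGraph (n * m)).Adj i j))


/-- In a J-colouring of the complement of `C_9`, exactly one of any two consecutive edges of `C_9`
is monochromatic. -/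
theorem IsJColoring.eq_succ_iff_of_compl_cycleGraph_nine {k : ℕ} {c : Fin 9 → Fin k}
    (hc : IsJColoring (cycleGraph 9)ᶜ k c) (v : Fin 9) :
    c v = c (v + 1) ↔ c (v + 1) ≠ c (v + 2) := by
  have adj_add_two : ∀ v : Fin 9, (cycleGraph 9)ᶜ.Adj v (v + 2) := by decide
  have eq_or_eq : ∀ v u : Fin 9, (u = v ∨ (cycleGraph 9)ᶜ.Adj v u) →
      ¬(cycleGraph 9)ᶜ.Adj u (v + 1) → u = v ∨ u = v + 2 := by decide
  constructor
  · intro h h'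
    exact hc.1 (adj_add_two v) (h.trans h')
  · intro h
    obtain ⟨u, hu, hcu⟩ := hc.2 v (c (v + 1))
    rcases eq_or_eq v u hu fun hadj => hc.1 hadj hcu with rfl | rfl
    · exact hcu
    · exact absurd hcu.symm h

theorem stmt15 : ¬ AdmitsJColoring (SimpleGraph.cycleGraph 9)ᶜ := by
  rintro ⟨k, -, c, hc⟩
  have h := hc.eq_succ_iff_of_compl_cycleGraph_nine
  simp only [Fin.forall_fin_succ, Fin.forall_fin_zero] at h
  simp +decide at h
  tauto
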